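/- arXiv:2510.22427 — 11 statements merged into one kernel-verified Lean document; each statement's English description precedes it below -/
import Mathlib

section
/- Let g be a Lie algebra over a field of characteristic zero that decomposes as a direct sum of vector subspaces g = g₊ ⊕ g₋, where g₊ and g₋ are Lie subalgebras of g. Let P₊ and P₋ denote the linear projections onto g₊ and g₋ along the complementary subspace, and set R = P₊ − P₋. Then for all X, Y ∈ g one has (1/2)([R X, Y] + [X, R Y]) = [P₊X, P₊Y] − [P₋X, P₋Y], and this bracket [X,Y]_R is bilinear, antisymmetric, and satisfies the Jacobi identity, i.e., it defines a second Lie algebra structure g_R on the underlying vector space of g. -/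
theorem lie_lie_cyclic {L : Type*} [LieRing L] (x y z : L) :
    ⁅⁅x, y⁆, z⁆ + ⁅⁅z, x⁆, y⁆ + ⁅⁅y, z⁆, x⁆ = 0 := by
  rw [← lie_skew ⁅x, y⁆ z, ← lie_skew ⁅z, x⁆ y, ← lie_skew ⁅y, z⁆ x, ← neg_add, ← neg_add,
    neg_eq_zero, ← lie_jacobi x y z]
  abel

/-- If `g = g₊ ⊕ g₋` with `g₊, g₋` Lie subalgebras, `P₊, P₋` the
projections onto `g₊, g₋` along the complement, and `R = P₊ − P₋`, then the
R-bracket `[X,Y]_R = (1/2)([RX,Y] + [X,RY])` equals `[P₊X,P₊Y] − [P₋X,P₋Y]`,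
is bilinear, antisymmetric, and satisfies the Jacobi identity. -/
theorem stmt0 {K L : Type*} [Field K] [CharZero K] [LieRing L] [LieAlgebra K L]
    (gp gm : LieSubalgebra K L)
    (hcompl : IsCompl gp.toSubmodule gm.toSubmodule)
    (Pp Pm : L →ₗ[K] L)
    (hPp_mem : ∀ x, Pp x ∈ gp) (hPm_mem : ∀ x, Pm x ∈ gm)
    (hsum : ∀ x, Pp x + Pm x = x)
    (hPp_fix : ∀ x ∈ gp, Pp x = x)
    (hPm_fix : ∀ x ∈ gm, Pm x = x)
    (R : L →ₗ[K] L) (hR : R = Pp - Pm)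
    (bR : L → L → L)
    (hbR : ∀ X Y, bR X Y = (1/2 : K) • (⁅R X, Y⁆ + ⁅X, R Y⁆)) :
    (∀ X Y : L, bR X Y = ⁅Pp X, Pp Y⁆ - ⁅Pm X, Pm Y⁆) ∧
    (∀ (c : K) (X X' Y : L), bR (c • X + X') Y = c • bR X Y + bR X' Y) ∧
    (∀ (c : K) (X Y Y' : L), bR X (c • Y + Y') = c • bR X Y + bR X Y') ∧
    (∀ X Y : L, bR X Y = - bR Y X) ∧
    (∀ X Y Z : L, bR (bR X Y) Z + bR (bR Z X) Y + bR (bR Y Z) X = 0) := by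
  have hformula : ∀ X Y : L, bR X Y = ⁅Pp X, Pp Y⁆ - ⁅Pm X, Pm Y⁆ := by
    intro X Y
    have key : ⁅R X, Y⁆ + ⁅X, R Y⁆ = (2 : K) • (⁅Pp X, Pp Y⁆ - ⁅Pm X, Pm Y⁆) := by
      have hl : ⁅R X, Y⁆ = ⁅Pp X - Pm X, Pp Y + Pm Y⁆ := by rw [hsum, hR, LinearMap.sub_apply]
      have hr : ⁅X, R Y⁆ = ⁅Pp X + Pm X, Pp Y - Pm Y⁆ := by rw [hsum, hR, LinearMap.sub_apply]
      rw [hl, hr]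
      simp only [lie_add, add_lie, lie_sub, sub_lie, two_smul]
      abel
    rw [hbR, key, smul_smul, one_div, inv_mul_cancel₀ two_ne_zero, one_smul]
  have hPp_zero : ∀ x ∈ gm, Pp x = 0 := fun x hx => by
    simpa [hPm_fix x hx] using hsum x
  have hPm_zero : ∀ x ∈ gp, Pm x = 0 := fun x hx => by
    simpa [hPp_fix x hx] using hsum x
  have hPp_bR : ∀ X Y, Pp (bR X Y) = ⁅Pp X, Pp Y⁆ := fun X Y => by
    rw [hformula, map_sub, hPp_fix _ (gp.lie_mem (hPp_mem X) (hPp_mem Y)),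
      hPp_zero _ (gm.lie_mem (hPm_mem X) (hPm_mem Y)), sub_zero]
  have hPm_bR : ∀ X Y, Pm (bR X Y) = -⁅Pm X, Pm Y⁆ := fun X Y => by
    rw [hformula, map_sub, hPm_fix _ (gm.lie_mem (hPm_mem X) (hPm_mem Y)),
      hPm_zero _ (gp.lie_mem (hPp_mem X) (hPp_mem Y)), zero_sub]
  refine ⟨hformula, fun c X X' Y => ?_, fun c X Y Y' => ?_, fun X Y => ?_, fun X Y Z => ?_⟩
  · simp only [hformula, map_add, map_smul, add_lie, smul_lie, smul_sub]
    abel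
  · simp only [hformula, map_add, map_smul, lie_add, lie_smul, smul_sub]
    abel
  · rw [hformula, hformula, ← lie_skew (Pp X), ← lie_skew (Pm X)]
    abel
  · have hp := lie_lie_cyclic (Pp X) (Pp Y) (Pp Z)
    have hm := lie_lie_cyclic (Pm X) (Pm Y) (Pm Z)
    rw [hformula (bR X Y), hformula (bR Z X), hformula (bR Y Z)]
    simp only [hPp_bR, hPm_bR, neg_lie, sub_neg_eq_add]
    rw [← add_zero (0 : L)]
    nth_rewrite 1 [← hp]
    rw [← hm]
    abel
end

section
/- Let g be a Lie algebra over a field of characteristic zero, R : g → g a linear map, and define B_R(X,Y) := [R X, R Y] − R([R X, Y] + [X, R Y]). Then the R-bracket [X,Y]_R := (1/2)([R X, Y] + [X, R Y]) satisfies the Jacobi identity [[X,Y]_R, Z]_R + [[Z,X]_R, Y]_R + [[Y,Z]_R, X]_R = 0 for all X, Y, Z ∈ g if and only if [B_R(X,Y), Z] + [B_R(Z,X), Y] + [B_R(Y,Z), X] = 0 for all X, Y, Z ∈ g. -/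
theorem lie_lie_cyclic_s3 {L : Type*} [LieRing L] (a b c : L) :
    ⁅⁅a, b⁆, c⁆ + ⁅⁅c, a⁆, b⁆ + ⁅⁅b, c⁆, a⁆ = 0 := by
  rw [← lie_skew ⁅a, b⁆ c, ← lie_skew ⁅c, a⁆ b, ← lie_skew ⁅b, c⁆ a, ← neg_add, ← neg_add,
    neg_eq_zero, ← lie_jacobi a b c]
  abel

/-- With `B_R(X,Y) := [RX,RY] − R([RX,Y] + [X,RY])`, the R-bracket
`[X,Y]_R = (1/2)([RX,Y]+[X,RY])` satisfies the Jacobi identity if and only if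
`[B_R(X,Y),Z] + [B_R(Z,X),Y] + [B_R(Y,Z),X] = 0` for all `X, Y, Z`. -/
theorem stmt3 {K L : Type*} [Field K] [CharZero K] [LieRing L] [LieAlgebra K L]
    (R : L →ₗ[K] L)
    (B : L → L → L)
    (hB : ∀ X Y, B X Y = ⁅R X, R Y⁆ - R (⁅R X, Y⁆ + ⁅X, R Y⁆))
    (bR : L → L → L)
    (hbR : ∀ X Y, bR X Y = (1/2 : K) • (⁅R X, Y⁆ + ⁅X, R Y⁆)) :
    (∀ X Y Z : L, bR (bR X Y) Z + bR (bR Z X) Y + bR (bR Y Z) X = 0) ↔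
    (∀ X Y Z : L, ⁅B X Y, Z⁆ + ⁅B Z X, Y⁆ + ⁅B Y Z, X⁆ = 0) := by
  have key (X Y Z : L) : bR (bR X Y) Z + bR (bR Z X) Y + bR (bR Y Z) X =
      (-(1 / 4) : K) • (⁅B X Y, Z⁆ + ⁅B Z X, Y⁆ + ⁅B Y Z, X⁆) := by
    have nested (X Y Z : L) : bR (bR X Y) Z = (1 / 4 : K) •
        (⁅R (⁅R X, Y⁆ + ⁅X, R Y⁆), Z⁆ + ⁅⁅R X, Y⁆ + ⁅X, R Y⁆, R Z⁆) := by
      rw [hbR (bR X Y) Z, hbR X Y, map_smul, smul_lie, smul_lie, ← smul_add, smul_smul]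
      norm_num
    rw [nested, nested, nested, ← smul_add, ← smul_add, neg_smul, ← smul_neg]
    congr 1
    rw [← sub_eq_zero, hB, hB, hB]
    simp only [sub_lie, add_lie]
    have h := congrArg₂ (· + ·) (congrArg₂ (· + ·) (lie_lie_cyclic_s3 (R X) (R Y) Z)
      (lie_lie_cyclic_s3 (R Y) (R Z) X)) (lie_lie_cyclic_s3 (R Z) (R X) Y)
    simp only [add_zero] at h
    rw [← h]
    abel
  have quarter_ne_zero : (-(1 / 4) : K) ≠ 0 := by norm_num
  simp only [key, smul_eq_zero_iff_right quarter_ne_zero]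
end

section
/- Let g be a Lie algebra over a field of characteristic zero and R : g → g a linear map satisfying the modified classical Yang–Baxter equation with constant c = 1. Set R₊ := (1/2)(R + id) and R₋ := (1/2)(R − id). Then for all X, Y ∈ g, [R₊X, R₊Y] = R₊([X,Y]_R) and [R₋X, R₋Y] = R₋([X,Y]_R); i.e., R₊ and R₋ are Lie algebra homomorphisms from g_R (the vector space g with bracket [·,·]_R) to g. -/
/-- If `R` satisfies the mCYBE with `c = 1` and
`R₊ = (1/2)(R + id)`, `R₋ = (1/2)(R − id)`, then `R₊` and `R₋` are Lie algebra
homomorphisms from `g_R` (with bracket `[X,Y]_R = (1/2)([RX,Y]+[X,RY])`) to `g`: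
`[R₊X, R₊Y] = R₊([X,Y]_R)` and `[R₋X, R₋Y] = R₋([X,Y]_R)`. -/
theorem stmt6 {K L : Type*} [Field K] [CharZero K] [LieRing L] [LieAlgebra K L]
    (R : L →ₗ[K] L)
    (hmcybe : ∀ X Y : L, ⁅R X, R Y⁆ - R (⁅R X, Y⁆ + ⁅X, R Y⁆) = -⁅X, Y⁆)
    (Rp Rm : L →ₗ[K] L)
    (hRp : Rp = (1/2 : K) • (R + (LinearMap.id : L →ₗ[K] L)))
    (hRm : Rm = (1/2 : K) • (R - (LinearMap.id : L →ₗ[K] L)))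
    (bR : L → L → L)
    (hbR : ∀ X Y, bR X Y = (1/2 : K) • (⁅R X, Y⁆ + ⁅X, R Y⁆)) :
    ∀ X Y : L, ⁅Rp X, Rp Y⁆ = Rp (bR X Y) ∧ ⁅Rm X, Rm Y⁆ = Rm (bR X Y) := by
  intro X Y
  have hRR : ⁅R X, R Y⁆ = R ⁅R X, Y⁆ + R ⁅X, R Y⁆ - ⁅X, Y⁆ := by
    rw [← map_add, sub_eq_add_neg, ← hmcybe X Y, add_sub_cancel]
  subst hRp hRm
  constructor
  · simp only [hbR, LinearMap.smul_apply, LinearMap.add_apply, LinearMap.id_apply, smul_lie,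
      lie_smul, add_lie, lie_add, map_smul, map_add, hRR]
    module
  · simp only [hbR, LinearMap.smul_apply, LinearMap.sub_apply, LinearMap.id_apply, smul_lie,
      lie_smul, sub_lie, lie_sub, map_smul, map_add, hRR]
    module
end

section
/- Let g be a Lie algebra over a field of characteristic zero and R : g → g a linear map satisfying the modified classical Yang–Baxter equation with constant c = 1. With R₊ := (1/2)(R + id) and R₋ := (1/2)(R − id), the map i_R : g_R → g × g sending X to (R₊X, R₋X) is an injective Lie algebra homomorphism from g_R (the vector space g with bracket [·,·]_R) into the product Lie algebra g × g; moreover every X ∈ g decomposes as X = R₊(X) − R₋(X). -/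
/-- If `R` satisfies the mCYBE with `c = 1`, with
`R₊ = (1/2)(R + id)` and `R₋ = (1/2)(R − id)`, the map
`i_R : X ↦ (R₊X, R₋X)` is an injective Lie algebra homomorphism from `g_R`
(bracket `[X,Y]_R = (1/2)([RX,Y]+[X,RY])`) into the product Lie algebra
`g × g` (componentwise bracket); moreover `X = R₊X − R₋X` for all `X`. -/
theorem stmt7 {K L : Type*} [Field K] [CharZero K] [LieRing L] [LieAlgebra K L]
    (R : L →ₗ[K] L)
    (hmcybe : ∀ X Y : L, ⁅R X, R Y⁆ - R (⁅R X, Y⁆ + ⁅X, R Y⁆) = -⁅X, Y⁆)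
    (Rp Rm : L →ₗ[K] L)
    (hRp : Rp = (1/2 : K) • (R + (LinearMap.id : L →ₗ[K] L)))
    (hRm : Rm = (1/2 : K) • (R - (LinearMap.id : L →ₗ[K] L)))
    (bR : L → L → L)
    (hbR : ∀ X Y, bR X Y = (1/2 : K) • (⁅R X, Y⁆ + ⁅X, R Y⁆))
    (iR : L → L × L) (hiR : ∀ X, iR X = (Rp X, Rm X)) :
    Function.Injective iR ∧
    (∀ X Y : L, iR (bR X Y) = (⁅(iR X).1, (iR Y).1⁆, ⁅(iR X).2, (iR Y).2⁆)) ∧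
    (∀ X : L, X = Rp X - Rm X) := by
  have hdecomp : ∀ X : L, X = Rp X - Rm X := by
    intro X
    simp only [hRp, hRm, LinearMap.smul_apply, LinearMap.add_apply, LinearMap.sub_apply,
      LinearMap.id_apply]
    module
  have hR : ∀ X Y : L, R (⁅R X, Y⁆ + ⁅X, R Y⁆) = ⁅R X, R Y⁆ + ⁅X, Y⁆ := by
    intro X Y
    rw [← sub_eq_iff_eq_add', ← neg_sub, hmcybe, neg_neg]
  refine ⟨fun X Y h => ?_, fun X Y => ?_, hdecomp⟩
  · rw [hiR, hiR, Prod.mk.injEq] at h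
    rw [hdecomp X, hdecomp Y, h.1, h.2]
  · simp only [hiR, hbR, hRp, hRm, LinearMap.smul_apply, LinearMap.add_apply,
      LinearMap.sub_apply, LinearMap.id_apply, map_smul, hR, smul_lie, lie_smul, add_lie,
      lie_add, sub_lie, lie_sub, Prod.mk.injEq]
    constructor <;> module
end

section
/- Let g be a Lie algebra over a field of characteristic zero and R : g → g a linear map satisfying the modified classical Yang–Baxter equation with constant c = 1. Set R₊ := (1/2)(R + id), R₋ := (1/2)(R − id), g₊ := Im R₊, g₋ := Im R₋, t₊ := Ker R₋, t₋ := Ker R₊. Then g₊ and g₋ are Lie subalgebras of g, t₊ ⊆ g₊ and t₋ ⊆ g₋ with t₊ a Lie ideal of g₊ and t₋ a Lie ideal of g₋, and the assignment θ_R : R₊X + t₊ ↦ R₋X + t₋ is a well-defined Lie algebra isomorphism from g₊/t₊ onto g₋/t₋. -/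
/-- If `[R X, R Y] - R ([R X, Y] + [X, R Y]) = -[X, Y]` and `ε ^ 2 = 1`, then `(1/2) (R + ε)` carries
the `R`-bracket to the original bracket. -/
theorem half_smul_add_smul_id_rBracket {K L : Type*} [Field K] [CharZero K] [LieRing L]
    [LieAlgebra K L] (R : L →ₗ[K] L)
    (hR : ∀ X Y : L, ⁅R X, R Y⁆ - R (⁅R X, Y⁆ + ⁅X, R Y⁆) = -⁅X, Y⁆)
    {ε : K} (hε : ε ^ 2 = 1) {P : L →ₗ[K] L}
    (hP : P = (1/2 : K) • (R + ε • (LinearMap.id : L →ₗ[K] L))) (X Y : L) :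
    P ((1/2 : K) • (⁅R X, Y⁆ + ⁅X, R Y⁆)) = ⁅P X, P Y⁆ := by
  have h : R (⁅R X, Y⁆ + ⁅X, R Y⁆) = ⁅R X, R Y⁆ + ⁅X, Y⁆ := by
    rw [sub_eq_iff_eq_add.mp (hR X Y)]; abel
  simp only [hP, map_smul, LinearMap.smul_apply, LinearMap.add_apply, LinearMap.id_apply, h,
    smul_lie, lie_smul, add_lie, lie_add]
  have hXY : ⁅X, Y⁆ = ε ^ 2 • ⁅X, Y⁆ := by rw [hε, one_smul]
  linear_combination (norm := module) (1/4 : K) • hXY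

/-- Let `P` and `Q` be commuting linear maps which are both multiplicative from a common bracket `B`
to the Lie bracket. If `P` maps `ker Q` onto a subspace containing `ker Q`, then the range of `P`
normalizes `ker Q`. -/
theorem lie_mem_ker_of_mem_range {K L : Type*} [Field K] [LieRing L] [LieAlgebra K L]
    {P Q : L →ₗ[K] L} {B : L → L → L} (hPQ : ∀ x, P (Q x) = Q (P x))
    (hP : ∀ x y, P (B x y) = ⁅P x, P y⁆) (hQ : ∀ x y, Q (B x y) = ⁅Q x, Q y⁆)
    (hker : ∀ y ∈ LinearMap.ker Q, y ∈ (LinearMap.ker Q).map P) :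
    ∀ x ∈ LinearMap.range P, ∀ y ∈ LinearMap.ker Q, ⁅x, y⁆ ∈ LinearMap.ker Q := by
  rintro _ ⟨x, rfl⟩ y hy
  obtain ⟨z, hz, rfl⟩ := hker y hy
  rw [LinearMap.mem_ker, ← hP, ← hPQ, hQ, LinearMap.mem_ker.mp hz, lie_zero, map_zero]

/-- If `R` satisfies the mCYBE with `c = 1`, set
`R₊ = (1/2)(R+id)`, `R₋ = (1/2)(R−id)`, `g₊ = Im R₊`, `g₋ = Im R₋`,
`t₊ = Ker R₋`, `t₋ = Ker R₊`. Then `g₊, g₋` are Lie subalgebras, `t₊ ⊆ g₊`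
and `t₋ ⊆ g₋` are Lie ideals of `g₊` resp. `g₋`, and
`θ_R : R₊X + t₊ ↦ R₋X + t₋` is a well-defined Lie algebra isomorphism
`g₊/t₊ → g₋/t₋` (expressed below elementwise: well-definedness together with
injectivity as the equivalence of the two coset conditions, and the Lie
homomorphism property modulo the ideals; surjectivity is automatic since every
coset of `g₋/t₋` has a representative `R₋X`). -/
theorem stmt8 {K L : Type*} [Field K] [CharZero K] [LieRing L] [LieAlgebra K L]
    (R : L →ₗ[K] L)
    (hmcybe : ∀ X Y : L, ⁅R X, R Y⁆ - R (⁅R X, Y⁆ + ⁅X, R Y⁆) = -⁅X, Y⁆)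
    (Rp Rm : L →ₗ[K] L)
    (hRp : Rp = (1/2 : K) • (R + (LinearMap.id : L →ₗ[K] L)))
    (hRm : Rm = (1/2 : K) • (R - (LinearMap.id : L →ₗ[K] L))) :
    (∀ x ∈ LinearMap.range Rp, ∀ y ∈ LinearMap.range Rp,
        ⁅x, y⁆ ∈ LinearMap.range Rp) ∧
    (∀ x ∈ LinearMap.range Rm, ∀ y ∈ LinearMap.range Rm,
        ⁅x, y⁆ ∈ LinearMap.range Rm) ∧
    LinearMap.ker Rm ≤ LinearMap.range Rp ∧
    LinearMap.ker Rp ≤ LinearMap.range Rm ∧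
    (∀ x ∈ LinearMap.range Rp, ∀ y ∈ LinearMap.ker Rm,
        ⁅x, y⁆ ∈ LinearMap.ker Rm) ∧
    (∀ x ∈ LinearMap.range Rm, ∀ y ∈ LinearMap.ker Rp,
        ⁅x, y⁆ ∈ LinearMap.ker Rp) ∧
    (∀ X Y : L, Rp X - Rp Y ∈ LinearMap.ker Rm ↔ Rm X - Rm Y ∈ LinearMap.ker Rp) ∧
    (∀ X Y : L, ∃ Z : L,
        ⁅Rp X, Rp Y⁆ - Rp Z ∈ LinearMap.ker Rm ∧
        ⁅Rm X, Rm Y⁆ - Rm Z ∈ LinearMap.ker Rp) := by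
  have hP : ∀ x y, Rp ((1/2 : K) • (⁅R x, y⁆ + ⁅x, R y⁆)) = ⁅Rp x, Rp y⁆ :=
    half_smul_add_smul_id_rBracket R hmcybe (one_pow 2) (by rw [hRp, one_smul])
  have hM : ∀ x y, Rm ((1/2 : K) • (⁅R x, y⁆ + ⁅x, R y⁆)) = ⁅Rm x, Rm y⁆ :=
    half_smul_add_smul_id_rBracket R hmcybe neg_one_sq (by rw [hRm, neg_one_smul, sub_eq_add_neg])
  have hsub : ∀ x, Rp x - Rm x = x := by
    intro x
    simp only [hRp, hRm, LinearMap.smul_apply, LinearMap.add_apply, LinearMap.sub_apply,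
      LinearMap.id_apply]
    module
  have hcomm : ∀ x, Rp (Rm x) = Rm (Rp x) := by
    intro x
    have h := congrArg Rm (hsub x)
    rw [map_sub, sub_eq_iff_eq_add] at h
    rw [h, ← sub_eq_iff_eq_add, hsub]
  have hkerM : ∀ y ∈ LinearMap.ker Rm, y ∈ (LinearMap.ker Rm).map Rp := fun y hy =>
    ⟨y, hy, by simpa [LinearMap.mem_ker.mp hy] using hsub y⟩
  have hkerP : ∀ y ∈ LinearMap.ker Rp, y ∈ (LinearMap.ker Rp).map Rm := fun y hy =>
    ⟨-y, neg_mem hy, by simpa [LinearMap.mem_ker.mp hy] using hsub y⟩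
  refine ⟨?_, ?_, fun y hy => LinearMap.map_le_range (hkerM y hy),
    fun y hy => LinearMap.map_le_range (hkerP y hy),
    lie_mem_ker_of_mem_range hcomm hP hM hkerM,
    lie_mem_ker_of_mem_range (fun x => (hcomm x).symm) hM hP hkerP, ?_, ?_⟩
  · rintro _ ⟨x, rfl⟩ _ ⟨y, rfl⟩
    exact ⟨_, hP x y⟩
  · rintro _ ⟨x, rfl⟩ _ ⟨y, rfl⟩
    exact ⟨_, hM x y⟩
  · intro X Y
    rw [← map_sub, ← map_sub, LinearMap.mem_ker, LinearMap.mem_ker, hcomm]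
  · intro X Y
    refine ⟨(1/2 : K) • (⁅R X, Y⁆ + ⁅X, R Y⁆), ?_, ?_⟩
    · rw [hP, sub_self]
      exact zero_mem _
    · rw [hM, sub_self]
      exact zero_mem _
end

section
/- Let g be a Lie algebra over a field of characteristic zero and R : g → g a linear map satisfying the modified classical Yang–Baxter equation with constant c = 1. In the product Lie algebra d = g × g (with componentwise bracket), let g^δ := {(X, X) : X ∈ g} be the diagonal subalgebra and let h := {(R₊X, R₋X) : X ∈ g} be the image of the embedding i_R, where R₊ := (1/2)(R + id) and R₋ := (1/2)(R − id). Then h is a Lie subalgebra of d and d decomposes as the direct sum of vector subspaces d = g^δ ⊕ h (i.e., g^δ and h are complementary subspaces of d). -/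
/-- If `R` satisfies the mCYBE with `c = 1`, then in the product
Lie algebra `d = g × g` (componentwise bracket), the image
`h = {(R₊X, R₋X)}` of `i_R` is a Lie subalgebra and `d = g^δ ⊕ h`, where
`g^δ = {(X,X)}` is the diagonal subalgebra. -/
theorem stmt9 {K L : Type*} [Field K] [CharZero K] [LieRing L] [LieAlgebra K L]
    (R : L →ₗ[K] L)
    (hmcybe : ∀ X Y : L, ⁅R X, R Y⁆ - R (⁅R X, Y⁆ + ⁅X, R Y⁆) = -⁅X, Y⁆)
    (Rp Rm : L →ₗ[K] L)
    (hRp : Rp = (1/2 : K) • (R + (LinearMap.id : L →ₗ[K] L)))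
    (hRm : Rm = (1/2 : K) • (R - (LinearMap.id : L →ₗ[K] L)))
    (diag h : Submodule K (L × L))
    (hdiag : diag = LinearMap.range
      ((LinearMap.id : L →ₗ[K] L).prod (LinearMap.id : L →ₗ[K] L)))
    (hh : h = LinearMap.range (Rp.prod Rm)) :
    (∀ a ∈ h, ∀ b ∈ h, ((⁅a.1, b.1⁆, ⁅a.2, b.2⁆) : L × L) ∈ h) ∧
    IsCompl diag h := by
  have hRmp : ∀ X, Rm X = Rp X - X := by
    intro X
    simp only [hRp, hRm, LinearMap.smul_apply, LinearMap.add_apply, LinearMap.sub_apply,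
      LinearMap.id_apply]
    module
  have key : ∀ X Y : L, ⁅R X, R Y⁆ = R (⁅R X, Y⁆ + ⁅X, R Y⁆) - ⁅X, Y⁆ := by
    intro X Y
    rw [sub_eq_add_neg, ← hmcybe X Y]
    abel
  subst hdiag hh
  refine ⟨?_, ?_, ?_⟩
  · rintro _ ⟨X, rfl⟩ _ ⟨Y, rfl⟩
    refine ⟨(1/2 : K) • (⁅R X, Y⁆ + ⁅X, R Y⁆), ?_⟩
    subst hRp hRm
    ext
    all_goals
      simp only [LinearMap.prod_apply, Function.prod, LinearMap.smul_apply, LinearMap.add_apply,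
        LinearMap.sub_apply, LinearMap.id_apply, smul_lie, lie_smul, add_lie, lie_add,
        sub_lie, lie_sub, key, map_smul, map_add,
        Prod.mk_add_mk, Prod.smul_mk]
      module
  · rw [Submodule.disjoint_def]
    rintro _ ⟨X, rfl⟩ ⟨Y, hY⟩
    simp only [LinearMap.prod_apply, Function.prod, LinearMap.id_apply, Prod.mk.injEq, hRmp] at hY
    obtain ⟨h₁, h₂⟩ := hY
    have hY0 : Y = 0 := by rwa [h₁, sub_eq_self] at h₂
    have hX0 : X = 0 := by rw [← h₁, hY0, map_zero]
    simp [hX0]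
  · rw [codisjoint_iff, Submodule.eq_top_iff']
    rintro ⟨a, b⟩
    refine Submodule.mem_sup.mpr
      ⟨_, ⟨a - Rp (a - b), rfl⟩, _, ⟨a - b, rfl⟩, ?_⟩
    simp only [LinearMap.prod_apply, Function.prod, LinearMap.id_apply, hRmp, Prod.mk_add_mk]
    ext
    · exact sub_add_cancel _ _
    · dsimp only
      abel
end

section
/- Let g be a Lie algebra over a field of characteristic zero and let h be a Lie subalgebra of the product Lie algebra g × g which is complementary, as a vector subspace, to the diagonal subalgebra g^δ = {(X,X) : X ∈ g} (i.e., h ⊕ g^δ = g × g). Then the linear map φ : h → g, (x, y) ↦ x − y, is a bijection; writing φ⁻¹(X) = (R₊X, R₋X), the maps R₊, R₋ : g → g are linear with R₊ − R₋ = id, and R := R₊ + R₋ satisfies the modified classical Yang–Baxter equation with constant c = 1: [R X, R Y] − R([R X, Y] + [X, R Y]) = −[X, Y] for all X, Y ∈ g. -/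
/-- The difference map `(x, y) ↦ x - y` restricted to a complement of the diagonal is bijective. -/
theorem bijective_fst_sub_snd_of_isCompl_diagonal {K M : Type*} [Ring K] [AddCommGroup M]
    [Module K M] {h : Submodule K (M × M)}
    (hcompl : IsCompl h (LinearMap.range
      ((LinearMap.id : M →ₗ[K] M).prod (LinearMap.id : M →ₗ[K] M)))) :
    Function.Bijective ((LinearMap.fst K M M - LinearMap.snd K M M) ∘ₗ h.subtype) := by
  constructor
  · rw [← LinearMap.ker_eq_bot, LinearMap.ker_eq_bot']
    rintro ⟨⟨x, y⟩, hp⟩ hxy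
    obtain rfl : x = y := by simpa [sub_eq_zero] using hxy
    exact Subtype.ext (Submodule.disjoint_def.mp hcompl.disjoint _ hp ⟨x, rfl⟩)
  · intro x
    have hx : ((x, 0) : M × M) ∈ h ⊔ LinearMap.range
        ((LinearMap.id : M →ₗ[K] M).prod (LinearMap.id : M →ₗ[K] M)) := by
      rw [hcompl.sup_eq_top]; trivial
    obtain ⟨u, hu, _, ⟨v, rfl⟩, huv⟩ := Submodule.mem_sup.mp hx
    refine ⟨⟨u, hu⟩, ?_⟩
    have h₁ : u.1 + v = x := congrArg Prod.fst huv
    have h₂ : u.2 + v = 0 := congrArg Prod.snd huv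
    change u.1 - u.2 = x
    rw [← add_sub_add_right_eq_sub u.1 u.2 v, h₁, h₂, sub_zero]


/-- If `h` is a Lie subalgebra of the product Lie algebra
`g × g` (componentwise bracket) complementary as a vector subspace to the
diagonal `g^δ = {(X,X)}`, then `φ : h → g, (x,y) ↦ x − y` is a bijection, and
writing `φ⁻¹(X) = (R₊X, R₋X)`, the maps `R₊, R₋` are linear with
`R₊ − R₋ = id`, and `R := R₊ + R₋` satisfies the mCYBE with `c = 1`. -/
theorem stmt10 {K L : Type*} [Field K] [CharZero K] [LieRing L] [LieAlgebra K L]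
    (h : Submodule K (L × L))
    (hclosed : ∀ a ∈ h, ∀ b ∈ h, ((⁅a.1, b.1⁆, ⁅a.2, b.2⁆) : L × L) ∈ h)
    (hcompl : IsCompl h (LinearMap.range
      ((LinearMap.id : L →ₗ[K] L).prod (LinearMap.id : L →ₗ[K] L)))) :
    Function.Bijective (fun p : h => (p : L × L).1 - (p : L × L).2) ∧
    ∃ Rp Rm : L →ₗ[K] L,
      (∀ X : L, (Rp X, Rm X) ∈ h ∧ Rp X - Rm X = X) ∧
      (∀ X Y : L,
        ⁅(Rp + Rm) X, (Rp + Rm) Y⁆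
          - (Rp + Rm) (⁅(Rp + Rm) X, Y⁆ + ⁅X, (Rp + Rm) Y⁆) = -⁅X, Y⁆) := by
  have hbij := bijective_fst_sub_snd_of_isCompl_diagonal hcompl
  let e := LinearEquiv.ofBijective _ hbij
  let Rp : L →ₗ[K] L := LinearMap.fst K L L ∘ₗ h.subtype ∘ₗ e.symm.toLinearMap
  let Rm : L →ₗ[K] L := LinearMap.snd K L L ∘ₗ h.subtype ∘ₗ e.symm.toLinearMap
  have hmem (X : L) : (Rp X, Rm X) ∈ h := (e.symm X).2
  have hsub (X : L) : Rp X - Rm X = X := e.apply_symm_apply X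
  have hsymm {x y : L} (hxy : (x, y) ∈ h) : Rp (x - y) = x ∧ Rm (x - y) = y := by
    have hz : e.symm (x - y) = ⟨(x, y), hxy⟩ := e.symm_apply_apply ⟨(x, y), hxy⟩
    exact ⟨congrArg (fun p : h => (p : L × L).1) hz, congrArg (fun p : h => (p : L × L).2) hz⟩
  refine ⟨hbij, Rp, Rm, fun X => ⟨hmem X, hsub X⟩, fun X Y => ?_⟩
  obtain ⟨hp, hm⟩ := hsymm (hclosed _ (hmem X) _ (hmem Y))
  have hX := hsub X
  have hY := hsub Y
  simp only [LinearMap.add_apply]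
  generalize Rp X = a, Rm X = b, Rp Y = c, Rm Y = d at *
  subst hX hY
  have hsum : ⁅a + b, c - d⁆ + ⁅a - b, c + d⁆ = (⁅a, c⁆ - ⁅b, d⁆) + (⁅a, c⁆ - ⁅b, d⁆) := by
    simp only [add_lie, sub_lie, lie_add, lie_sub]
    abel
  rw [hsum, map_add, map_add, hp, hm]
  simp only [add_lie, sub_lie, lie_add, lie_sub]
  abel
end

section
/- Let g be a Lie algebra over a field of characteristic zero and ā : g* → g a skew-symmetric linear map (⟨η, āξ⟩ = −⟨ξ, āη⟩ for all ξ, η ∈ g*). Define the bracket [ξ,η]_a := ad*_{āξ} η − ad*_{āη} ξ on g*. If ā satisfies the classical Yang–Baxter condition that for all ξ, η, ζ ∈ g*: ⟨ζ, [āξ, āη]⟩ + ⟨ξ, [āη, āζ]⟩ + ⟨η, [āζ, āξ]⟩ = 0 (i.e., the Schouten bracket ⟦a,a⟧ vanishes, so ā is a triangular r-matrix), then [·,·]_a is antisymmetric and satisfies the Jacobi identity, hence defines a Lie algebra structure on g*. -/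
/-- The coadjoint action of `X ∈ g` on `ξ ∈ g*`: `⟨ad*_X ξ, Y⟩ = −⟨ξ, [X,Y]⟩`. -/
def coad {K L : Type*} [Field K] [LieRing L] [LieAlgebra K L]
    (X : L) (ξ : Module.Dual K L) : Module.Dual K L :=
  -(ξ ∘ₗ LieAlgebra.ad K L X)

theorem coad_apply {K L : Type*} [Field K] [LieRing L] [LieAlgebra K L]
    (X : L) (ξ : Module.Dual K L) (Y : L) : coad X ξ Y = -ξ ⁅X, Y⁆ := rfl

/-- The classical Yang–Baxter condition makes `ā` a bracket homomorphism. -/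
theorem abar_coad_sub_coad {K L : Type*} [Field K] [LieRing L] [LieAlgebra K L]
    (abar : Module.Dual K L →ₗ[K] L)
    (hskew : ∀ ξ η : Module.Dual K L, η (abar ξ) = -(ξ (abar η)))
    (hcyb : ∀ ξ η ζ : Module.Dual K L,
      ζ ⁅abar ξ, abar η⁆ + ξ ⁅abar η, abar ζ⁆ + η ⁅abar ζ, abar ξ⁆ = 0)
    (ξ η : Module.Dual K L) :
    abar (coad (abar ξ) η - coad (abar η) ξ) = ⁅abar ξ, abar η⁆ := by
  rw [← sub_eq_zero, ← Module.forall_dual_apply_eq_zero_iff K]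
  intro ζ
  have hη : η ⁅abar ζ, abar ξ⁆ = -η ⁅abar ξ, abar ζ⁆ := by rw [← lie_skew, map_neg]
  rw [map_sub, hskew, LinearMap.sub_apply, coad_apply, coad_apply]
  linear_combination -hcyb ξ η ζ + hη

/-- For a skew-symmetric linear map `ā : g* → g` satisfying the
classical Yang–Baxter condition `⟨ζ,[āξ,āη]⟩ + ⟨ξ,[āη,āζ]⟩ + ⟨η,[āζ,āξ]⟩ = 0`
(vanishing Schouten bracket, triangular r-matrix), the bracket
`[ξ,η]_a = ad*_{āξ}η − ad*_{āη}ξ` is antisymmetric and satisfies the Jacobi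
identity, hence defines a Lie algebra structure on `g*`. -/
theorem stmt12 {K L : Type*} [Field K] [CharZero K] [LieRing L] [LieAlgebra K L]
    (abar : Module.Dual K L →ₗ[K] L)
    (hskew : ∀ ξ η : Module.Dual K L, η (abar ξ) = -(ξ (abar η)))
    (bra : Module.Dual K L → Module.Dual K L → Module.Dual K L)
    (hbra : ∀ ξ η, bra ξ η = coad (abar ξ) η - coad (abar η) ξ)
    (hcyb : ∀ ξ η ζ : Module.Dual K L,
      ζ ⁅abar ξ, abar η⁆ + ξ ⁅abar η, abar ζ⁆ + η ⁅abar ζ, abar ξ⁆ = 0) :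
    (∀ ξ η : Module.Dual K L, bra ξ η = -bra η ξ) ∧
    (∀ ξ η ζ : Module.Dual K L,
      bra (bra ξ η) ζ + bra (bra η ζ) ξ + bra (bra ζ ξ) η = 0) := by
  refine ⟨fun ξ η => by rw [hbra, hbra, neg_sub], fun ξ η ζ => ?_⟩
  have habar (ξ η : Module.Dual K L) : abar (bra ξ η) = ⁅abar ξ, abar η⁆ := by
    rw [hbra, abar_coad_sub_coad abar hskew hcyb]
  have hexpand (ξ η ζ : Module.Dual K L) (Y : L) : bra (bra ξ η) ζ Y =
      -(ζ ⁅abar ξ, ⁅abar η, Y⁆⁆ - ζ ⁅abar η, ⁅abar ξ, Y⁆⁆)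
        - η ⁅abar ξ, ⁅abar ζ, Y⁆⁆ + ξ ⁅abar η, ⁅abar ζ, Y⁆⁆ := by
    rw [hbra, habar, hbra ξ η]
    simp only [LinearMap.sub_apply, coad_apply, lie_lie, map_sub]
    ring
  ext Y
  simp only [LinearMap.add_apply, LinearMap.zero_apply, hexpand]
  ring
end

section
/- Let g be a Lie algebra over a field of characteristic zero and s̄ : g* → g a symmetric linear map (⟨η, s̄ξ⟩ = ⟨ξ, s̄η⟩ for all ξ, η ∈ g*) which is ad-invariant, i.e., s̄(ad*_X ξ) = [X, s̄ξ] for all X ∈ g and ξ ∈ g*. Then the trilinear form T(ξ,η,ζ) := ⟨ζ, [s̄ξ, s̄η]⟩ on g* is totally antisymmetric, and it is ad-invariant: T(ad*_X ξ, η, ζ) + T(ξ, ad*_X η, ζ) + T(ξ, η, ad*_X ζ) = 0 for all X ∈ g and all ξ, η, ζ ∈ g*. (This is the statement that ⟨s,s⟩ is an ad-invariant element of Λ³g with ⟨s,s⟩-bar(ξ,η) = [s̄ξ, s̄η].) -/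
/-- For a symmetric, ad-invariant linear map `s̄ : g* → g`, the
trilinear form `T(ξ,η,ζ) = ⟨ζ, [s̄ξ, s̄η]⟩` is totally antisymmetric and
ad-invariant:
`T(ad*_X ξ,η,ζ) + T(ξ,ad*_X η,ζ) + T(ξ,η,ad*_X ζ) = 0`. -/
theorem stmt15 {K L : Type*} [Field K] [CharZero K] [LieRing L] [LieAlgebra K L]
    (sbar : Module.Dual K L →ₗ[K] L)
    (hsymm : ∀ ξ η : Module.Dual K L, η (sbar ξ) = ξ (sbar η))
    (hinv : ∀ (X : L) (ξ : Module.Dual K L), sbar (coad X ξ) = ⁅X, sbar ξ⁆)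
    (T : Module.Dual K L → Module.Dual K L → Module.Dual K L → K)
    (hT : ∀ ξ η ζ, T ξ η ζ = ζ ⁅sbar ξ, sbar η⁆) :
    (∀ ξ η ζ : Module.Dual K L, T ξ η ζ = -T η ξ ζ) ∧
    (∀ ξ η ζ : Module.Dual K L, T ξ η ζ = -T ξ ζ η) ∧
    (∀ (X : L) (ξ η ζ : Module.Dual K L),
      T (coad X ξ) η ζ + T ξ (coad X η) ζ + T ξ η (coad X ζ) = 0) := by
  refine ⟨fun ξ η ζ => ?_, fun ξ η ζ => ?_, fun X ξ η ζ => ?_⟩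
  · rw [hT, hT, ← lie_skew, map_neg]
  · rw [hT, hT, ← hinv, hsymm, coad_apply]
  · rw [hT, hT, hT, hinv, hinv, coad_apply, leibniz_lie X, map_add]
    ring
end

section
/- Let g be a Lie algebra over a field of characteristic zero, ā : g* → g a skew-symmetric linear map (⟨η, āξ⟩ = −⟨ξ, āη⟩), and s̄ : g* → g a symmetric, ad-invariant linear map (⟨η, s̄ξ⟩ = ⟨ξ, s̄η⟩ and s̄(ad*_X ξ) = [X, s̄ξ] for all X ∈ g, ξ ∈ g*). Set r̄₊ := ā + s̄ and r̄₋ := ā − s̄, and define the bracket [ξ,η]_r := ad*_{āξ} η − ad*_{āη} ξ on g*. Then the following are equivalent: (i) [r̄₊ξ, r̄₊η] − r̄₊([ξ,η]_r) = 0 for all ξ, η ∈ g* (i.e., ⟨r,r⟩ = 0, the classical Yang–Baxter equation for r = a + s, so r is quasi-triangular); (ii) both r̄₊ and r̄₋ are Lie algebra morphisms from (g*, [·,·]_r) to g, i.e., r̄₊([ξ,η]_r) = [r̄₊ξ, r̄₊η] and r̄₋([ξ,η]_r) = [r̄₋ξ, r̄₋η] for all ξ, η ∈ g*. -/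
/-- For `r = a + s` with `ā` skew-symmetric and `s̄` symmetric and
ad-invariant, setting `r̄₊ = ā + s̄`, `r̄₋ = ā − s̄` and
`[ξ,η]_r = ad*_{āξ}η − ad*_{āη}ξ`, the following are equivalent:
(i) `[r̄₊ξ, r̄₊η] − r̄₊([ξ,η]_r) = 0` for all `ξ, η` (i.e. `⟨r,r⟩ = 0`, the CYBE,
so `r` is quasi-triangular);
(ii) both `r̄₊` and `r̄₋` are Lie algebra morphisms from `(g*, [·,·]_r)` to `g`. -/
theorem stmt16 {K L : Type*} [Field K] [CharZero K] [LieRing L] [LieAlgebra K L]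
    (abar sbar : Module.Dual K L →ₗ[K] L)
    (hskew : ∀ ξ η : Module.Dual K L, η (abar ξ) = -(ξ (abar η)))
    (hsymm : ∀ ξ η : Module.Dual K L, η (sbar ξ) = ξ (sbar η))
    (hinv : ∀ (X : L) (ξ : Module.Dual K L), sbar (coad X ξ) = ⁅X, sbar ξ⁆)
    (rp rm : Module.Dual K L →ₗ[K] L)
    (hrp : rp = abar + sbar) (hrm : rm = abar - sbar)
    (bra : Module.Dual K L → Module.Dual K L → Module.Dual K L)
    (hbra : ∀ ξ η, bra ξ η = coad (abar ξ) η - coad (abar η) ξ) :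
    (∀ ξ η : Module.Dual K L, ⁅rp ξ, rp η⁆ - rp (bra ξ η) = 0) ↔
    ((∀ ξ η : Module.Dual K L, rp (bra ξ η) = ⁅rp ξ, rp η⁆) ∧
     (∀ ξ η : Module.Dual K L, rm (bra ξ η) = ⁅rm ξ, rm η⁆)) := by
  have hs : ∀ ξ η, sbar (bra ξ η) = ⁅abar ξ, sbar η⁆ + ⁅sbar ξ, abar η⁆ := fun ξ η => by
    rw [hbra, map_sub, hinv, hinv, ← lie_skew (sbar ξ) (abar η), sub_eq_add_neg]
  have hdefect : ∀ ξ η, ⁅rm ξ, rm η⁆ - rm (bra ξ η) = ⁅rp ξ, rp η⁆ - rp (bra ξ η) := fun ξ η => by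
    simp only [hrp, hrm, LinearMap.add_apply, LinearMap.sub_apply, hs, lie_add, lie_sub,
      add_lie, sub_lie]
    abel
  refine ⟨fun h => ⟨fun ξ η => (sub_eq_zero.mp (h ξ η)).symm, fun ξ η => ?_⟩,
    fun h ξ η => sub_eq_zero.mpr (h.1 ξ η).symm⟩
  exact (sub_eq_zero.mp ((hdefect ξ η).trans (h ξ η))).symm
end

section
/- Let g be a Lie algebra over a field of characteristic zero, ā : g* → g a skew-symmetric linear map (⟨η, āξ⟩ = −⟨ξ, āη⟩), and s̄ : g* → g a symmetric, ad-invariant, bijective linear map (⟨η, s̄ξ⟩ = ⟨ξ, s̄η⟩ and s̄(ad*_X ξ) = [X, s̄ξ] for all X, ξ), so that r = a + s is a factorisable r-matrix. Define R := ā ∘ s̄⁻¹ : g → g. Then ā = R ∘ s̄, the composition R ∘ s̄ is skew-symmetric, and for all X, Y ∈ g: [R X, Y] + [X, R Y] = s̄([s̄⁻¹X, s̄⁻¹Y]_a), where [ξ,η]_a := ad*_{āξ} η − ad*_{āη} ξ is the bracket on g* induced by ā. -/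
/-- For a factorisable r-matrix `r = a + s` (`ā` skew-symmetric,
`s̄` symmetric, ad-invariant and bijective, with linear inverse `s̄⁻¹`), setting
`R := ā ∘ s̄⁻¹ : g → g` one has `ā = R ∘ s̄`, the composition `R ∘ s̄` is
skew-symmetric, and `[RX, Y] + [X, RY] = s̄([s̄⁻¹X, s̄⁻¹Y]_a)` where
`[ξ,η]_a = ad*_{āξ}η − ad*_{āη}ξ`. -/
theorem stmt17 {K L : Type*} [Field K] [CharZero K] [LieRing L] [LieAlgebra K L]
    (abar sbar : Module.Dual K L →ₗ[K] L)
    (hskew : ∀ ξ η : Module.Dual K L, η (abar ξ) = -(ξ (abar η)))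
    (hsymm : ∀ ξ η : Module.Dual K L, η (sbar ξ) = ξ (sbar η))
    (hinvariant : ∀ (X : L) (ξ : Module.Dual K L), sbar (coad X ξ) = ⁅X, sbar ξ⁆)
    (sinv : L →ₗ[K] Module.Dual K L)
    (hsinv₁ : ∀ X : L, sbar (sinv X) = X)
    (hsinv₂ : ∀ ξ : Module.Dual K L, sinv (sbar ξ) = ξ)
    (R : L →ₗ[K] L) (hR : R = abar ∘ₗ sinv)
    (bra : Module.Dual K L → Module.Dual K L → Module.Dual K L)
    (hbra : ∀ ξ η, bra ξ η = coad (abar ξ) η - coad (abar η) ξ) :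
    (abar = R ∘ₗ sbar) ∧
    (∀ ξ η : Module.Dual K L, η ((R ∘ₗ sbar) ξ) = -(ξ ((R ∘ₗ sbar) η))) ∧
    (∀ X Y : L, ⁅R X, Y⁆ + ⁅X, R Y⁆ = sbar (bra (sinv X) (sinv Y))) := by
  have habar : abar = R ∘ₗ sbar := by
    ext ξ
    simp [hR, hsinv₂]
  refine ⟨habar, fun ξ η => habar ▸ hskew ξ η, fun X Y => ?_⟩
  have hRX : ∀ Z, abar (sinv Z) = R Z := fun Z => by simp [hR]
  rw [hbra, map_sub, hinvariant, hinvariant, hRX, hRX, hsinv₁, hsinv₁, ← lie_skew X (R Y),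
    sub_eq_add_neg]
end
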